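/- If a tree T of order n(T) ≥ 2 belongs to the family 𝒯, then γ_t^{oi}(S(T)) = (4n(T) − l(T) + s(T) − 2)/3. -/

import Mathlib

open SimpleGraph

universe u

/-- A total outer-independent dominating set: every vertex has a neighbor in `D`,
and the complement of `D` is an independent set. -/
def IsTOIDS {V : Type u} (G : SimpleGraph V) (D : Set V) : Prop :=
  (∀ v : V, ∃ u ∈ D, G.Adj v u) ∧ ∀ u ∉ D, ∀ w ∉ D, ¬ G.Adj u w

/-- The total outer-independent domination number. -/
noncomputable def toidNumber {V : Type u} (G : SimpleGraph V) : ℕ :=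
  sInf {n : ℕ | ∃ D : Set V, IsTOIDS G D ∧ D.ncard = n}

/-- The subdivision graph: each edge is replaced by a new vertex adjacent exactly to
its two endpoints. -/
def subdivision {V : Type u} (G : SimpleGraph V) : SimpleGraph (V ⊕ G.edgeSet) :=
  SimpleGraph.fromRel fun x y =>
    ∃ (v : V) (e : G.edgeSet), x = Sum.inl v ∧ y = Sum.inr e ∧ v ∈ (e : Sym2 V)

/-- A leaf: a vertex with exactly one neighbor. -/
def IsLeafVert {V : Type u} (G : SimpleGraph V) (v : V) : Prop := ∃! u, G.Adj v u

/-- A support vertex: a vertex adjacent to a leaf. -/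
def IsSupportVert {V : Type u} (G : SimpleGraph V) (v : V) : Prop :=
  ∃ u, G.Adj v u ∧ IsLeafVert G u

/-- A strong support vertex: a vertex adjacent to at least two leaves. -/
def IsStrongSupportVert {V : Type u} (G : SimpleGraph V) (v : V) : Prop :=
  ∃ u w, u ≠ w ∧ G.Adj v u ∧ G.Adj v w ∧ IsLeafVert G u ∧ IsLeafVert G w

/-- A strong leaf: a leaf adjacent to a strong support vertex. -/
def IsStrongLeaf {V : Type u} (G : SimpleGraph V) (v : V) : Prop :=
  IsLeafVert G v ∧ ∃ u, G.Adj v u ∧ IsStrongSupportVert G u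

/-- A weak leaf: a leaf that is not a strong leaf. -/
def IsWeakLeaf {V : Type u} (G : SimpleGraph V) (v : V) : Prop :=
  IsLeafVert G v ∧ ¬ IsStrongLeaf G v

/-- A semi-support vertex: neither a leaf nor a support vertex, but adjacent to a
support vertex. -/
def IsSemiSupportVert {V : Type u} (G : SimpleGraph V) (v : V) : Prop :=
  ¬ IsLeafVert G v ∧ ¬ IsSupportVert G v ∧ ∃ u, G.Adj v u ∧ IsSupportVert G u

/-- The number of leaves, with the convention that `P₂` has exactly one leaf. -/
noncomputable def leafCount {V : Type u} (G : SimpleGraph V) : ℕ :=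
  if Nat.card V = 2 then 1 else {v | IsLeafVert G v}.ncard

/-- The number of support vertices, with the convention that `P₂` has exactly one
support vertex. -/
noncomputable def supportCount {V : Type u} (G : SimpleGraph V) : ℕ :=
  if Nat.card V = 2 then 1 else {v | IsSupportVert G v}.ncard

/-- The graph obtained from `G` by attaching a path `P_r` to the vertex `v`:
the new vertices form a path `p₀ p₁ ⋯ p_{r-1}` and `v` is joined to the end `p₀`. -/
def attachPath {V : Type u} (G : SimpleGraph V) (v : V) (r : ℕ) :
    SimpleGraph (V ⊕ Fin r) :=
  SimpleGraph.fromRel fun x y =>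
    (∃ a b, x = Sum.inl a ∧ y = Sum.inl b ∧ G.Adj a b) ∨
    (∃ i j : Fin r, x = Sum.inr i ∧ y = Sum.inr j ∧ (j : ℕ) = (i : ℕ) + 1) ∨
    (∃ i : Fin r, x = Sum.inl v ∧ y = Sum.inr i ∧ (i : ℕ) = 0)

/-- The graph obtained from `G` by adding a disjoint copy of the tree `Q_r`
(`r` paths `P₃` joined to a central vertex) and identifying the central vertex
of `Q_r` with the vertex `v` of `G`. -/
def attachQ {V : Type u} (G : SimpleGraph V) (v : V) (r : ℕ) :
    SimpleGraph (V ⊕ Fin r × Fin 3) :=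
  SimpleGraph.fromRel fun x y =>
    (∃ a b, x = Sum.inl a ∧ y = Sum.inl b ∧ G.Adj a b) ∨
    (∃ i : Fin r, x = Sum.inl v ∧ y = Sum.inr (i, 0)) ∨
    (∃ (i : Fin r) (j k : Fin 3),
      x = Sum.inr (i, j) ∧ y = Sum.inr (i, k) ∧ (k : ℕ) = (j : ℕ) + 1)

/-- The family `F`: all trees obtainable from `P₂` by repeatedly
(F1) attaching `P₁` to a support vertex, (F2) attaching `P₂` to a support or
semi-support vertex, (F3) attaching `P₃` to a weak leaf. -/
inductive InFamilyF : {W : Type u} → SimpleGraph W → Prop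
  | base {W : Type u} (G : SimpleGraph W) (e : G ≃g SimpleGraph.pathGraph 2) :
      InFamilyF G
  | op1 {W : Type u} {G' : SimpleGraph W} {v : W} (hv : IsSupportVert G' v)
      (hF : InFamilyF G') {U : Type u} (G : SimpleGraph U)
      (e : G ≃g attachPath G' v 1) : InFamilyF G
  | op2 {W : Type u} {G' : SimpleGraph W} {v : W}
      (hv : IsSupportVert G' v ∨ IsSemiSupportVert G' v)
      (hF : InFamilyF G') {U : Type u} (G : SimpleGraph U)
      (e : G ≃g attachPath G' v 2) : InFamilyF G
  | op3 {W : Type u} {G' : SimpleGraph W} {v : W} (hv : IsWeakLeaf G' v)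
      (hF : InFamilyF G') {U : Type u} (G : SimpleGraph U)
      (e : G ≃g attachPath G' v 3) : InFamilyF G

/-- The family `𝒯`: all trees obtainable from `P₂` by repeatedly
(O1) attaching `P₁` to a support vertex, (O2) attaching `P₃` to a support vertex or a
weak leaf, (O3) adding a copy of `Q_r` (`r ≥ 2`) identifying its central vertex with a
weak leaf. -/
inductive InFamilyT : {W : Type u} → SimpleGraph W → Prop
  | base {W : Type u} (G : SimpleGraph W) (e : G ≃g SimpleGraph.pathGraph 2) :
      InFamilyT G
  | op1 {W : Type u} {G' : SimpleGraph W} {v : W} (hv : IsSupportVert G' v)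
      (hF : InFamilyT G') {U : Type u} (G : SimpleGraph U)
      (e : G ≃g attachPath G' v 1) : InFamilyT G
  | op2 {W : Type u} {G' : SimpleGraph W} {v : W}
      (hv : IsSupportVert G' v ∨ IsWeakLeaf G' v)
      (hF : InFamilyT G') {U : Type u} (G : SimpleGraph U)
      (e : G ≃g attachPath G' v 3) : InFamilyT G
  | op3 {W : Type u} {G' : SimpleGraph W} {v : W} (hv : IsWeakLeaf G' v)
      (hF : InFamilyT G') {r : ℕ} (hr : 2 ≤ r) {U : Type u} (G : SimpleGraph U)
      (e : G ≃g attachQ G' v r) : InFamilyT G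

section CoverPairs

variable {V W : Type u} {G : SimpleGraph V} {H : SimpleGraph W}

/-- The trace of a total outer-independent dominating set of the subdivision of `G` on the
vertices (`A`) and on the edges (`B`) of `G`. -/
structure IsCoverPair (G : SimpleGraph V) (A : Set V) (B : Set (Sym2 V)) : Prop where
  exists_edge : ∀ v, ∃ w, G.Adj v w ∧ s(v, w) ∈ B
  mem_or_mem : ∀ u w, G.Adj u w → u ∈ A ∨ w ∈ A
  mem_or_edge_mem : ∀ u w, G.Adj u w → u ∈ A ∨ s(u, w) ∈ B

/-- `G` has a cover pair of total size at most `k`. -/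
def HasCoverPair (G : SimpleGraph V) (k : ℕ) : Prop :=
  ∃ A B, IsCoverPair G A B ∧ A.ncard + B.ncard ≤ k

@[simp] lemma subdivision_adj_inl_inr (v : V) (e : G.edgeSet) :
    (subdivision G).Adj (Sum.inl v) (Sum.inr e) ↔ v ∈ (e : Sym2 V) := by
  simp [subdivision]

@[simp] lemma subdivision_adj_inr_inl (v : V) (e : G.edgeSet) :
    (subdivision G).Adj (Sum.inr e) (Sum.inl v) ↔ v ∈ (e : Sym2 V) := by
  simp [subdivision]

@[simp] lemma subdivision_not_adj_inl_inl (v w : V) :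
    ¬ (subdivision G).Adj (Sum.inl v) (Sum.inl w) := by
  simp [subdivision]

@[simp] lemma subdivision_not_adj_inr_inr (e f : G.edgeSet) :
    ¬ (subdivision G).Adj (Sum.inr e) (Sum.inr f) := by
  simp [subdivision]

lemma ncard_eq_add_of_sum {α β : Type*} [Finite α] [Finite β] (S : Set (α ⊕ β)) :
    S.ncard = (Sum.inl ⁻¹' S).ncard + (Sum.inr ⁻¹' S).ncard := by
  have h : S = Sum.inl '' (Sum.inl ⁻¹' S) ∪ Sum.inr '' (Sum.inr ⁻¹' S) := by
    ext (x | x) <;> simp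
  conv_lhs => rw [h]
  rw [Set.ncard_union_eq, Set.ncard_image_of_injective _ Sum.inl_injective,
    Set.ncard_image_of_injective _ Sum.inr_injective]
  rw [Set.disjoint_left]
  rintro _ ⟨x, -, rfl⟩ ⟨y, -, h⟩
  cases h

lemma IsTOIDS.hasCoverPair [Finite V] {D : Set (V ⊕ G.edgeSet)}
    (hD : IsTOIDS (subdivision G) D) : HasCoverPair G D.ncard := by
  refine ⟨Sum.inl ⁻¹' D, Subtype.val '' (Sum.inr ⁻¹' D), ⟨?_, ?_, ?_⟩, ?_⟩
  · intro v
    obtain ⟨x | e, hx, hadj⟩ := hD.1 (Sum.inl v)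
    · simp at hadj
    · rw [subdivision_adj_inl_inr] at hadj
      obtain ⟨w, hw⟩ := hadj
      refine ⟨w, ?_, ⟨e, hx, hw⟩⟩
      rw [← SimpleGraph.mem_edgeSet, ← hw]
      exact e.2
  · intro u w h
    obtain ⟨x | e, hx, hadj⟩ := hD.1 (Sum.inr ⟨s(u, w), h⟩)
    · rw [subdivision_adj_inr_inl] at hadj
      rcases Sym2.mem_iff.1 hadj with rfl | rfl
      · exact Or.inl hx
      · exact Or.inr hx
    · simp at hadj
  · intro u w h
    by_contra! hc
    refine hD.2 (Sum.inl u) hc.1 (Sum.inr ⟨s(u, w), h⟩) (fun hm => hc.2 ⟨_, hm, rfl⟩) ?_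
    simp
  · rw [ncard_eq_add_of_sum D, Set.ncard_image_of_injective _ Subtype.val_injective]

lemma HasCoverPair.exists_isTOIDS [Finite V] {k : ℕ} (h : HasCoverPair G k) :
    ∃ D, IsTOIDS (subdivision G) D ∧ D.ncard ≤ k := by
  obtain ⟨A, B, hAB, hk⟩ := h
  refine ⟨{x | Sum.elim (· ∈ A) (fun e : G.edgeSet => (e : Sym2 V) ∈ B) x}, ⟨?_, ?_⟩, ?_⟩
  · rintro (v | ⟨⟨u, w⟩, h⟩)
    · obtain ⟨w, hw, hB⟩ := hAB.exists_edge v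
      exact ⟨Sum.inr ⟨s(v, w), hw⟩, hB, by simp⟩
    · rcases hAB.mem_or_mem u w h with hu | hw
      · exact ⟨Sum.inl u, hu, by simp⟩
      · exact ⟨Sum.inl w, hw, by simp⟩
  · have key : ∀ u ∉ A, ∀ e : G.edgeSet, (e : Sym2 V) ∉ B → u ∉ (e : Sym2 V) := by
      rintro u hu ⟨e, he⟩ heB ⟨w, rfl⟩
      exact (hAB.mem_or_edge_mem u w he).elim hu heB
    rintro (u | e) hu (w | f) hw
    · simp
    · rw [subdivision_adj_inl_inr]; exact key u hu f hw
    · rw [subdivision_adj_inr_inl]; exact key w hw e hu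
    · simp
  · rw [ncard_eq_add_of_sum]
    refine le_trans (Nat.add_le_add (le_of_eq rfl) ?_) hk
    exact Set.ncard_le_ncard_of_injOn Subtype.val (fun e he => he)
      Subtype.val_injective.injOn

lemma toidNumber_subdivision_eq [Finite V] {k : ℕ} (h : IsLeast {m | HasCoverPair G m} k) :
    toidNumber (subdivision G) = k := by
  obtain ⟨D, hD, hDk⟩ := HasCoverPair.exists_isTOIDS h.1
  refine le_antisymm (le_trans (Nat.sInf_le ⟨D, hD, rfl⟩) hDk) ?_
  refine le_csInf ⟨_, D, hD, rfl⟩ ?_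
  rintro _ ⟨D', hD', rfl⟩
  exact h.2 hD'.hasCoverPair

lemma HasCoverPair.of_iso [Finite V] (e : G ≃g H) {k : ℕ} (h : HasCoverPair G k) :
    HasCoverPair H k := by
  obtain ⟨A, B, hAB, hk⟩ := h
  have hs : ∀ u w, s(e.symm u, e.symm w) ∈ B → s(u, w) ∈ Sym2.map e '' B :=
    fun u w h => ⟨_, h, by simp⟩
  have hA : ∀ u, e.symm u ∈ A → u ∈ e '' A := fun u h => ⟨_, h, by simp⟩
  refine ⟨e '' A, Sym2.map e '' B, ⟨fun v => ?_, fun u w h => ?_, fun u w h => ?_⟩, ?_⟩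
  · obtain ⟨w, hw, hB⟩ := hAB.exists_edge (e.symm v)
    refine ⟨e w, ?_, hs _ _ (by simpa using hB)⟩
    simpa using e.map_adj_iff.2 hw
  · exact (hAB.mem_or_mem _ _ (e.symm.map_adj_iff.2 h)).imp (hA u) (hA w)
  · exact (hAB.mem_or_edge_mem _ _ (e.symm.map_adj_iff.2 h)).imp (hA u) (hs u w)
  · exact le_trans (Nat.add_le_add (Set.ncard_image_le A.toFinite)
      (Set.ncard_image_le B.toFinite)) hk

end CoverPairs

section Leaves

variable {V W : Type u} {G : SimpleGraph V} {H : SimpleGraph W}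

lemma isLeafVert_iso (e : G ≃g H) (v : V) : IsLeafVert H (e v) ↔ IsLeafVert G v := by
  constructor
  · rintro ⟨u, hu, h⟩
    refine ⟨e.symm u, ?_, fun w hw => ?_⟩
    · simpa using e.symm.map_adj_iff.2 hu
    · simp [← h (e w) (e.map_adj_iff.2 hw)]
  · rintro ⟨u, hu, h⟩
    refine ⟨e u, e.map_adj_iff.2 hu, fun w hw => ?_⟩
    have := h (e.symm w) (by simpa using e.symm.map_adj_iff.2 hw)
    simp [← this]

lemma isSupportVert_iso (e : G ≃g H) (v : V) : IsSupportVert H (e v) ↔ IsSupportVert G v := by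
  constructor
  · rintro ⟨u, hu, h⟩
    refine ⟨e.symm u, ?_, ?_⟩
    · simpa using e.symm.map_adj_iff.2 hu
    · rw [← isLeafVert_iso e]; simpa using h
  · rintro ⟨u, hu, h⟩
    exact ⟨e u, e.map_adj_iff.2 hu, (isLeafVert_iso e u).2 h⟩

lemma ncard_setOf_of_iso (e : G ≃g H) {p : V → Prop} {q : W → Prop}
    (h : ∀ v, q (e v) ↔ p v) : {v | q v}.ncard = {v | p v}.ncard := by
  rw [← Set.ncard_image_of_injective {v | p v} e.injective]
  congr 1
  ext w
  obtain ⟨v, rfl⟩ := e.surjective w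
  simp [h]

/-- The leaves of `G` other than `v`. -/
def leavesAway (G : SimpleGraph V) (v : V) : Set V := {x | IsLeafVert G x ∧ x ≠ v}

/-- The vertices of `G` adjacent to a leaf other than `v`. -/
def supportsAway (G : SimpleGraph V) (v : V) : Set V :=
  {x | ∃ u, G.Adj x u ∧ IsLeafVert G u ∧ u ≠ v}

lemma isWeakLeaf_of_isSupportVert {v : V} (hv : IsLeafVert G v) (hs : IsSupportVert G v) :
    IsWeakLeaf G v := by
  refine ⟨hv, ?_⟩
  rintro ⟨-, u, hu, a, b, hab, ha, hb, -, -⟩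
  obtain ⟨w, hw, hl⟩ := hs
  obtain rfl := hv.unique hu hw
  exact hab (hl.unique ha hb)

lemma leavesAway_add_supports [Finite V] {v : V} (hv : IsSupportVert G v ∨ IsWeakLeaf G v) :
    (leavesAway G v).ncard + {x | IsSupportVert G x}.ncard =
      {x | IsLeafVert G x}.ncard + (supportsAway G v).ncard := by
  by_cases hl : IsLeafVert G v
  · have hw : IsWeakLeaf G v := hv.elim (isWeakLeaf_of_isSupportVert hl) id
    obtain ⟨w, hvw, -⟩ := id hl
    have h1 : leavesAway G v = {x | IsLeafVert G x} \ {v} := by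
      ext x; simp [leavesAway]
    have h2 : supportsAway G v = {x | IsSupportVert G x} \ {w} := by
      ext x
      constructor
      · rintro ⟨u, hxu, hu, huv⟩
        refine ⟨⟨u, hxu, hu⟩, ?_⟩
        rintro rfl
        exact hw.2 ⟨hl, x, hvw, u, v, huv, hxu, hvw.symm, hu, hl⟩
      · rintro ⟨⟨u, hxu, hu⟩, hxw⟩
        refine ⟨u, hxu, hu, ?_⟩
        rintro rfl
        exact hxw (hl.unique hxu.symm hvw)
    have h3 := Set.ncard_sdiff_singleton_add_one (s := {x | IsLeafVert G x}) (a := v) hl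
    have h4 := Set.ncard_sdiff_singleton_add_one (s := {x | IsSupportVert G x}) (a := w)
      ⟨v, hvw.symm, hl⟩
    rw [h1, h2]
    omega
  · have h1 : leavesAway G v = {x | IsLeafVert G x} := by
      ext x
      exact ⟨fun h => h.1, fun h => ⟨h, fun hx => hl (hx ▸ h)⟩⟩
    have h2 : supportsAway G v = {x | IsSupportVert G x} := by
      ext x
      constructor
      · rintro ⟨u, hxu, hu, -⟩
        exact ⟨u, hxu, hu⟩
      · rintro ⟨u, hxu, hu⟩
        exact ⟨u, hxu, hu, fun hx => hl (hx ▸ hu)⟩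
    rw [h1, h2]

end Leaves

section Restriction

variable {V : Type u} {G : SimpleGraph V}

/-- A pair that is a cover pair except possibly at a support vertex or leaf `v` can be repaired
without increasing its size. -/
lemma HasCoverPair.of_almost [Finite V] {v : V} (hv : IsSupportVert G v ∨ IsLeafVert G v)
    {A : Set V} {B : Set (Sym2 V)} (hcov : ∀ x ≠ v, ∃ w, G.Adj x w ∧ s(x, w) ∈ B)
    (hA : ∀ u w, G.Adj u w → u ∈ A ∨ w ∈ A) (hB : ∀ u w, G.Adj u w → u ∈ A ∨ s(u, w) ∈ B) :
    HasCoverPair G (A.ncard + B.ncard) := by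
  by_cases h : ∃ w, G.Adj v w ∧ s(v, w) ∈ B
  · exact ⟨A, B, ⟨fun x => (eq_or_ne x v).elim (fun hx => hx ▸ h) (hcov x), hA, hB⟩, le_rfl⟩
  rcases hv with ⟨u, hvu, hu⟩ | ⟨w, hvw, hw⟩
  · obtain ⟨x, hx, hxB⟩ := hcov u hvu.ne'
    obtain rfl := hu.unique hx hvu.symm
    exact absurd ⟨u, hvu, by rwa [Sym2.eq_swap]⟩ h
  · have hnB : s(v, w) ∉ B := fun hm => h ⟨w, hvw, hm⟩
    have hvA : v ∈ A := (hB v w hvw).resolve_right hnB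
    have hwA : w ∈ A := (hB w v hvw.symm).resolve_right (by rwa [Sym2.eq_swap])
    refine ⟨A \ {v}, insert s(v, w) B, ⟨fun x => ?_, fun x y hxy => ?_, fun x y hxy => ?_⟩, ?_⟩
    · by_cases hx : x = v
      · subst hx
        exact ⟨w, hvw, Set.mem_insert _ _⟩
      · obtain ⟨y, hy, hyB⟩ := hcov x hx
        exact ⟨y, hy, Set.mem_insert_of_mem _ hyB⟩
    · by_cases hx : x = v
      · subst hx
        obtain rfl := hw y hxy
        exact Or.inr ⟨hwA, hxy.ne'⟩
      · by_cases hy : y = v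
        · subst hy
          obtain rfl := hw x hxy.symm
          exact Or.inl ⟨hwA, hx⟩
        · exact (hA x y hxy).imp (fun h => ⟨h, hx⟩) (fun h => ⟨h, hy⟩)
    · by_cases hx : x = v
      · subst hx
        obtain rfl := hw y hxy
        exact Or.inr (Set.mem_insert _ _)
      · exact (hB x y hxy).imp (fun h => ⟨h, hx⟩) (Set.mem_insert_of_mem _)
    · have h1 := Set.ncard_sdiff_singleton_add_one hvA
      have h2 := Set.ncard_insert_le s(v, w) B
      omega

/-- At a support vertex `v`, a cover pair may be assumed to contain `v`. -/
lemma HasCoverPair.exists_mem [Finite V] {v : V} (hv : IsSupportVert G v) {k : ℕ}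
    (h : HasCoverPair G k) : ∃ A B, IsCoverPair G A B ∧ A.ncard + B.ncard ≤ k ∧ v ∈ A := by
  obtain ⟨A, B, hAB, hk⟩ := h
  by_cases hvA : v ∈ A
  · exact ⟨A, B, hAB, hk, hvA⟩
  obtain ⟨u, hvu, hu⟩ := hv
  have huA : u ∈ A := (hAB.mem_or_mem v u hvu).resolve_left hvA
  have hvuB : s(v, u) ∈ B := (hAB.mem_or_edge_mem v u hvu).resolve_left hvA
  refine ⟨insert v (A \ {u}), B, ⟨hAB.exists_edge, fun x y hxy => ?_, fun x y hxy => ?_⟩, ?_,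
    Set.mem_insert _ _⟩
  · by_cases hx : x = u
    · subst hx
      exact Or.inr (Or.inl (hu.unique hxy hvu.symm))
    · by_cases hy : y = u
      · subst hy
        exact Or.inl (Or.inl (hu.unique hxy.symm hvu.symm))
      · exact (hAB.mem_or_mem x y hxy).imp (fun h => Or.inr ⟨h, hx⟩) (fun h => Or.inr ⟨h, hy⟩)
  · by_cases hx : x = u
    · subst hx
      obtain rfl := hu.unique hxy hvu.symm
      exact Or.inr (by rwa [Sym2.eq_swap])
    · exact (hAB.mem_or_edge_mem x y hxy).imp_left (fun h => Or.inr ⟨h, hx⟩)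
  · have h1 := Set.ncard_sdiff_singleton_add_one huA
    have h2 := Set.ncard_insert_le v (A \ {u})
    omega

/-- The parts of `B` lying in the disjoint ranges of two injections `f` and `g`. -/
lemma ncard_preimage_add_le {α β γ : Type*} [Finite γ] {f : α → γ} {g : β → γ}
    (hf : Function.Injective f) (hg : Function.Injective g) (hfg : ∀ a b, f a ≠ g b)
    (B : Set γ) : (f ⁻¹' B).ncard + (g ⁻¹' B).ncard ≤ B.ncard := by
  rw [← Set.ncard_image_of_injective _ hf, ← Set.ncard_image_of_injective _ hg,
    ← Set.ncard_union_eq]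
  · refine Set.ncard_le_ncard ?_
    rintro _ (⟨x, hx, rfl⟩ | ⟨x, hx, rfl⟩) <;> exact hx
  · rw [Set.disjoint_left]
    rintro _ ⟨x, -, rfl⟩ ⟨y, -, h⟩
    exact hfg x y h.symm

end Restriction

section AttachLeaf

variable {V : Type u} {G : SimpleGraph V} {v : V}

@[simp] lemma attachPath_adj_inl_inl {r : ℕ} (a b : V) :
    (attachPath G v r).Adj (Sum.inl a) (Sum.inl b) ↔ G.Adj a b := by
  simp only [attachPath, SimpleGraph.fromRel_adj]
  simp only [ne_eq, Sum.inl.injEq, reduceCtorEq, false_and, and_false, exists_false, or_false]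
  constructor
  · rintro ⟨-, ⟨a', b', rfl, rfl, h⟩ | ⟨a', b', rfl, rfl, h⟩⟩
    · exact h
    · exact h.symm
  · exact fun h => ⟨h.ne, Or.inl ⟨a, b, rfl, rfl, h⟩⟩

@[simp] lemma attachPath_adj_inl_inr {r : ℕ} (a : V) (i : Fin r) :
    (attachPath G v r).Adj (Sum.inl a) (Sum.inr i) ↔ a = v ∧ (i : ℕ) = 0 := by
  simp [attachPath]

@[simp] lemma attachPath_adj_inr_inl {r : ℕ} (a : V) (i : Fin r) :
    (attachPath G v r).Adj (Sum.inr i) (Sum.inl a) ↔ a = v ∧ (i : ℕ) = 0 := by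
  simp [attachPath]

@[simp] lemma attachPath_adj_inr_inr {r : ℕ} (i j : Fin r) :
    (attachPath G v r).Adj (Sum.inr i) (Sum.inr j) ↔
      (j : ℕ) = (i : ℕ) + 1 ∨ (i : ℕ) = (j : ℕ) + 1 := by
  simp [attachPath]
  rintro h rfl
  omega

@[simp] lemma attachQ_adj_inl_inl {r : ℕ} (a b : V) :
    (attachQ G v r).Adj (Sum.inl a) (Sum.inl b) ↔ G.Adj a b := by
  simp only [attachQ, SimpleGraph.fromRel_adj]
  simp only [ne_eq, Sum.inl.injEq, reduceCtorEq, false_and, and_false, exists_false, or_false]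
  constructor
  · rintro ⟨-, ⟨a', b', rfl, rfl, h⟩ | ⟨a', b', rfl, rfl, h⟩⟩
    · exact h
    · exact h.symm
  · exact fun h => ⟨h.ne, Or.inl ⟨a, b, rfl, rfl, h⟩⟩

@[simp] lemma attachQ_adj_inl_inr {r : ℕ} (a : V) (i : Fin r) (j : Fin 3) :
    (attachQ G v r).Adj (Sum.inl a) (Sum.inr (i, j)) ↔ a = v ∧ j = 0 := by
  simp [attachQ]

@[simp] lemma attachQ_adj_inr_inl {r : ℕ} (a : V) (i : Fin r) (j : Fin 3) :
    (attachQ G v r).Adj (Sum.inr (i, j)) (Sum.inl a) ↔ a = v ∧ j = 0 := by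
  simp [attachQ]

@[simp] lemma attachQ_adj_inr_inr {r : ℕ} (i i' : Fin r) (j k : Fin 3) :
    (attachQ G v r).Adj (Sum.inr (i, j)) (Sum.inr (i', k)) ↔
      i = i' ∧ ((k : ℕ) = (j : ℕ) + 1 ∨ (j : ℕ) = (k : ℕ) + 1) := by
  simp only [attachQ, SimpleGraph.fromRel_adj]
  constructor
  · rintro ⟨-, (⟨_, _, h, -⟩ | ⟨_, h, -⟩ | ⟨a, b, c, h, h', h3⟩) |
      (⟨_, _, h, -⟩ | ⟨_, h, -⟩ | ⟨a, b, c, h, h', h3⟩)⟩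
    all_goals cases h
    all_goals cases h'
    · exact ⟨rfl, Or.inl h3⟩
    · exact ⟨rfl, Or.inr h3⟩
  · rintro ⟨rfl, h⟩
    refine ⟨?_, h.imp (fun h => Or.inr (Or.inr ⟨i, j, k, rfl, rfl, h⟩))
      (fun h => Or.inr (Or.inr ⟨i, k, j, rfl, rfl, h⟩))⟩
    intro heq
    simp only [Sum.inr.injEq, Prod.mk.injEq, true_and] at heq
    subst heq
    omega

/-- Attaching a single `P₃` is the same as attaching `Q_1`. -/
def attachPathThreeIso (G : SimpleGraph V) (v : V) : attachPath G v 3 ≃g attachQ G v 1 where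
  toEquiv := Equiv.sumCongr (Equiv.refl V) (Equiv.uniqueProd (Fin 3) (Fin 1)).symm
  map_rel_iff' := by
    have h : ∀ i : Fin 3, (Equiv.uniqueProd (Fin 3) (Fin 1)).symm i = (0, i) := fun i => rfl
    rintro (a | i) (b | j) <;> simp only [Equiv.sumCongr_apply, Sum.map_inl, Sum.map_inr, h,
      Equiv.refl_apply, attachQ_adj_inl_inl, attachQ_adj_inl_inr, attachQ_adj_inr_inl,
      attachQ_adj_inr_inr, attachPath_adj_inl_inl, attachPath_adj_inl_inr,
      attachPath_adj_inr_inl, attachPath_adj_inr_inr, Fin.ext_iff, true_and, Fin.val_zero]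

lemma HasCoverPair.attachPath_one [Finite V] (hv : IsSupportVert G v) {k : ℕ}
    (h : HasCoverPair G k) : HasCoverPair (attachPath G v 1) (k + 1) := by
  obtain ⟨A, B, hAB, hk, hvA⟩ := h.exists_mem hv
  refine ⟨Sum.inl '' A, insert s(Sum.inl v, Sum.inr 0) (Sym2.map Sum.inl '' B),
    ⟨?_, ?_, ?_⟩, ?_⟩
  · rintro (x | i)
    · obtain ⟨w, hw, hB⟩ := hAB.exists_edge x
      exact ⟨Sum.inl w, by simpa using hw, Or.inr ⟨_, hB, rfl⟩⟩
    · exact ⟨Sum.inl v, by simp, Or.inl (by rw [Sym2.eq_swap, Subsingleton.elim i 0])⟩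
  · rintro (x | i) (y | j) h
    · simpa using hAB.mem_or_mem x y (by simpa using h)
    · simp only [attachPath_adj_inl_inr] at h
      exact Or.inl ⟨v, hvA, by rw [h.1]⟩
    · simp only [attachPath_adj_inr_inl] at h
      exact Or.inr ⟨v, hvA, by rw [h.1]⟩
    · simp only [attachPath_adj_inr_inr] at h
      omega
  · rintro (x | i) (y | j) h
    · refine (hAB.mem_or_edge_mem x y (by simpa using h)).imp (fun h => ⟨x, h, rfl⟩)
        (fun h => Or.inr ⟨_, h, rfl⟩)
    · simp only [attachPath_adj_inl_inr] at h
      exact Or.inl ⟨v, hvA, by rw [h.1]⟩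
    · simp only [attachPath_adj_inr_inl] at h
      refine Or.inr (Or.inl ?_)
      rw [h.1, Sym2.eq_swap, Subsingleton.elim i 0]
    · simp only [attachPath_adj_inr_inr] at h
      omega
  · have h1 := Set.ncard_image_le (f := (Sum.inl : V → V ⊕ Fin 1)) A.toFinite
    have h2 := Set.ncard_image_le (f := Sym2.map (Sum.inl : V → V ⊕ Fin 1)) B.toFinite
    have h3 := Set.ncard_insert_le s((Sum.inl v : V ⊕ Fin 1), Sum.inr 0)
      (Sym2.map Sum.inl '' B)
    omega

lemma HasCoverPair.of_attachPath_one [Finite V] (hv : IsSupportVert G v) {m : ℕ}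
    (h : HasCoverPair (attachPath G v 1) m) : ∃ k, HasCoverPair G k ∧ k + 1 ≤ m := by
  obtain ⟨A, B, hAB, hm⟩ := h
  refine ⟨_, HasCoverPair.of_almost (Or.inl hv) (A := Sum.inl ⁻¹' A)
    (B := Sym2.map Sum.inl ⁻¹' B) ?_ ?_ ?_, ?_⟩
  · intro x hx
    obtain ⟨y | i, hy, hyB⟩ := hAB.exists_edge (Sum.inl x)
    · exact ⟨y, by simpa using hy, hyB⟩
    · simp only [attachPath_adj_inl_inr] at hy
      exact absurd hy.1 hx
  · intro x y hxy
    exact hAB.mem_or_mem (Sum.inl x) (Sum.inl y) (by simpa using hxy)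
  · intro x y hxy
    exact hAB.mem_or_edge_mem (Sum.inl x) (Sum.inl y) (by simpa using hxy)
  · have h1 := ncard_eq_add_of_sum A
    have h2 : s(Sum.inl v, Sum.inr 0) ∈ B := by
      obtain ⟨y | i, hy, hyB⟩ := hAB.exists_edge (Sum.inr 0)
      · simp only [attachPath_adj_inr_inl] at hy
        rwa [hy.1, Sym2.eq_swap] at hyB
      · simp only [attachPath_adj_inr_inr] at hy
        omega
    have h3 := ncard_preimage_add_le (f := Sym2.map (Sum.inl : V → V ⊕ Fin 1))
      (g := fun _ : Unit => s(Sum.inl v, Sum.inr 0)) (Sym2.map.injective Sum.inl_injective)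
      (fun _ _ _ => rfl) (by rintro ⟨a, b⟩ _; simp) B
    have h4 : ((fun _ : Unit => s((Sum.inl v : V ⊕ Fin 1), Sum.inr 0)) ⁻¹' B) = Set.univ := by
      ext; simp [h2]
    rw [h4, Set.ncard_univ, Nat.card_unique] at h3
    omega

lemma isLeafVert_attachPath_one_inl (hv : IsSupportVert G v) (x : V) :
    IsLeafVert (attachPath G v 1) (Sum.inl x) ↔ x ∈ leavesAway G v := by
  constructor
  · rintro ⟨y, hy, h⟩
    have hxv : x ≠ v := by
      rintro rfl
      obtain ⟨u, hu, -⟩ := hv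
      have h1 := h (Sum.inl u) (by simpa using hu)
      have h2 := h (Sum.inr 0) (by simp)
      rw [← h2] at h1
      cases h1
    refine ⟨?_, hxv⟩
    rcases y with y | i
    · refine ⟨y, by simpa using hy, fun z hz => ?_⟩
      simpa using h (Sum.inl z) (by simpa using hz)
    · simp only [attachPath_adj_inl_inr] at hy
      exact absurd hy.1 hxv
  · rintro ⟨⟨y, hy, h⟩, hxv⟩
    refine ⟨Sum.inl y, by simpa using hy, ?_⟩
    rintro (z | i) hz
    · rw [h z (by simpa using hz)]
    · simp only [attachPath_adj_inl_inr] at hz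
      exact absurd hz.1 hxv

lemma isLeafVert_attachPath_one_inr (i : Fin 1) :
    IsLeafVert (attachPath G v 1) (Sum.inr i) := by
  refine ⟨Sum.inl v, by simp, ?_⟩
  rintro (z | j) hz
  · simp only [attachPath_adj_inr_inl] at hz
    rw [hz.1]
  · simp only [attachPath_adj_inr_inr] at hz
    omega

lemma isSupportVert_attachPath_one_inl (hv : IsSupportVert G v) (x : V) :
    IsSupportVert (attachPath G v 1) (Sum.inl x) ↔ x ∈ supportsAway G v := by
  constructor
  · rintro ⟨y | i, hy, h⟩
    · rw [isLeafVert_attachPath_one_inl hv] at h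
      exact ⟨y, by simpa using hy, h⟩
    · simp only [attachPath_adj_inl_inr] at hy
      obtain ⟨u, hu, hl⟩ := hv
      rw [hy.1]
      exact ⟨u, hu, hl, hu.ne'⟩
  · rintro ⟨u, hxu, hu⟩
    exact ⟨Sum.inl u, by simpa using hxu, (isLeafVert_attachPath_one_inl hv u).2 hu⟩

lemma not_isSupportVert_attachPath_one_inr (hv : IsSupportVert G v) (i : Fin 1) :
    ¬ IsSupportVert (attachPath G v 1) (Sum.inr i) := by
  rintro ⟨y | j, hy, h⟩
  · rw [isLeafVert_attachPath_one_inl hv] at h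
    simp only [attachPath_adj_inr_inl] at hy
    exact h.2 hy.1
  · simp only [attachPath_adj_inr_inr] at hy
    omega

lemma ncard_leaves_attachPath_one [Finite V] (hv : IsSupportVert G v) :
    {x | IsLeafVert (attachPath G v 1) x}.ncard = (leavesAway G v).ncard + 1 := by
  rw [ncard_eq_add_of_sum]
  simp [isLeafVert_attachPath_one_inl hv, isLeafVert_attachPath_one_inr, Set.preimage]

lemma ncard_supports_attachPath_one [Finite V] (hv : IsSupportVert G v) :
    {x | IsSupportVert (attachPath G v 1) x}.ncard = (supportsAway G v).ncard := by
  rw [ncard_eq_add_of_sum]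
  simp [isSupportVert_attachPath_one_inl hv, not_isSupportVert_attachPath_one_inr hv,
    Set.preimage]

end AttachLeaf

section AttachQ

variable {V : Type u} {G : SimpleGraph V} {v : V} {r : ℕ}

lemma HasCoverPair.attachQ [Finite V] {k : ℕ} (h : HasCoverPair G k) :
    HasCoverPair (attachQ G v r) (k + 4 * r) := by
  obtain ⟨A, B, hAB, hk⟩ := h
  refine ⟨Sum.inl '' A ∪ (Set.range (fun i => Sum.inr (i, 0)) ∪
      Set.range (fun i => Sum.inr (i, 1))),
    Sym2.map Sum.inl '' B ∪ (Set.range (fun i => s(Sum.inl v, Sum.inr (i, 0))) ∪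
      Set.range (fun i => s(Sum.inr (i, 1), Sum.inr (i, 2)))),
    ⟨?_, ?_, ?_⟩, ?_⟩
  · rintro (x | ⟨i, j⟩)
    · obtain ⟨w, hw, hB⟩ := hAB.exists_edge x
      exact ⟨Sum.inl w, by simpa using hw, Or.inl ⟨_, hB, rfl⟩⟩
    · fin_cases j
      · exact ⟨Sum.inl v, by simp, Or.inr (Or.inl ⟨i, Sym2.eq_swap⟩)⟩
      · exact ⟨Sum.inr (i, 2), by simp, Or.inr (Or.inr ⟨i, rfl⟩)⟩
      · exact ⟨Sum.inr (i, 1), by simp, Or.inr (Or.inr ⟨i, Sym2.eq_swap⟩)⟩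
  · rintro (x | ⟨i, j⟩) (y | ⟨i', j'⟩) h
    · simpa using hAB.mem_or_mem x y (by simpa using h)
    · simp only [attachQ_adj_inl_inr] at h
      simp [h.2]
    · simp only [attachQ_adj_inr_inl] at h
      simp [h.2]
    · simp only [attachQ_adj_inr_inr] at h
      fin_cases j <;> fin_cases j' <;> simp at h ⊢
  · rintro (x | ⟨i, j⟩) (y | ⟨i', j'⟩) h
    · exact (hAB.mem_or_edge_mem x y (by simpa using h)).imp (fun h => Or.inl ⟨x, h, rfl⟩)
        (fun h => Or.inl ⟨_, h, rfl⟩)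
    · simp only [attachQ_adj_inl_inr] at h
      obtain ⟨rfl, rfl⟩ := h
      exact Or.inr (Or.inr (Or.inl ⟨i', rfl⟩))
    · simp only [attachQ_adj_inr_inl] at h
      simp [h.2]
    · simp only [attachQ_adj_inr_inr] at h
      obtain ⟨rfl, h⟩ := h
      fin_cases j <;> fin_cases j' <;> simp at h ⊢
  · have hr : ∀ {γ : Type u} (f : Fin r → γ), (Set.range f).ncard ≤ r := fun f => by
      rw [← Set.image_univ]
      refine (Set.ncard_image_le Set.finite_univ).trans ?_
      simp [Set.ncard_univ]
    refine (Nat.add_le_add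
      ((Set.ncard_union_le _ _).trans (Nat.add_le_add (Set.ncard_image_le A.toFinite)
        ((Set.ncard_union_le _ _).trans (Nat.add_le_add (hr _) (hr _)))))
      ((Set.ncard_union_le _ _).trans (Nat.add_le_add (Set.ncard_image_le B.toFinite)
        ((Set.ncard_union_le _ _).trans (Nat.add_le_add (hr _) (hr _)))))).trans ?_
    omega

/-- The edges of `attachQ G v r` outside `G`. -/
def attachQEdge (v : V) (p : Fin r × Fin 3) : Sym2 (V ⊕ Fin r × Fin 3) :=
  match p with
  | (i, 0) => s(Sum.inl v, Sum.inr (i, 0))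
  | (i, 1) => s(Sum.inr (i, 0), Sum.inr (i, 1))
  | (i, 2) => s(Sum.inr (i, 1), Sum.inr (i, 2))

lemma attachQEdge_injective (v : V) : Function.Injective (attachQEdge (r := r) v) := by
  rintro ⟨i, j⟩ ⟨i', j'⟩ h
  fin_cases j <;> fin_cases j' <;> simp [attachQEdge] at h ⊢ <;> exact h

lemma map_inl_ne_attachQEdge (v : V) (e : Sym2 V) (p : Fin r × Fin 3) :
    Sym2.map Sum.inl e ≠ attachQEdge v p := by
  obtain ⟨a, b⟩ := e
  obtain ⟨i, j⟩ := p
  fin_cases j <;> simp [attachQEdge]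

lemma ncard_eq_sum_of_prod (S : Set (Fin r × Fin 3)) [DecidablePred (· ∈ S)] :
    S.ncard = ∑ i, ((if (i, 0) ∈ S then 1 else 0) + (if (i, 1) ∈ S then 1 else 0) +
      (if (i, 2) ∈ S then 1 else 0)) := by
  have h : S = ↑(Finset.univ.filter (· ∈ S)) := by simp
  conv_lhs => rw [h]
  rw [Set.ncard_coe_finset, Finset.card_filter, Fintype.sum_prod_type]
  simp only [Fin.sum_univ_three]

open Classical in
lemma IsCoverPair.four_mul_le {A : Set (V ⊕ Fin r × Fin 3)} {B : Set (Sym2 (V ⊕ Fin r × Fin 3))}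
    (h : IsCoverPair (_root_.attachQ G v r) A B) :
    4 * r ≤ (Sum.inr ⁻¹' A).ncard + (attachQEdge v ⁻¹' B).ncard := by
  rw [ncard_eq_sum_of_prod, ncard_eq_sum_of_prod, ← Finset.sum_add_distrib]
  have h0 : ∑ _i : Fin r, 4 = 4 * r := by simp [mul_comm]
  rw [← h0]
  refine Finset.sum_le_sum fun i _ => ?_
  have hbc : s(Sum.inr (i, 1), Sum.inr (i, 2)) ∈ B := by
    obtain ⟨y | ⟨i', j⟩, hy, hyB⟩ := h.exists_edge (Sum.inr (i, 2))
    · simp at hy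
    · simp only [attachQ_adj_inr_inr] at hy
      obtain ⟨rfl, hj⟩ := hy
      obtain rfl : j = 1 := by ext; simp at hj ⊢; omega
      rwa [Sym2.eq_swap]
  have hb := h.mem_or_mem (Sum.inr (i, 1)) (Sum.inr (i, 2)) (by simp)
  have ha := h.mem_or_edge_mem (Sum.inr (i, 0)) (Sum.inr (i, 1)) (by simp)
  have ha' := h.mem_or_edge_mem (Sum.inr (i, 0)) (Sum.inl v) (by simp)
  rw [Sym2.eq_swap] at ha'
  have hc : s(Sum.inl v, Sum.inr (i, 0)) ∈ B ∨ s(Sum.inr (i, 0), Sum.inr (i, 1)) ∈ B := by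
    obtain ⟨y | ⟨i', j⟩, hy, hyB⟩ := h.exists_edge (Sum.inr (i, 0))
    · simp only [attachQ_adj_inr_inl] at hy
      rw [hy.1, Sym2.eq_swap] at hyB
      exact Or.inl hyB
    · simp only [attachQ_adj_inr_inr] at hy
      obtain ⟨rfl, hj⟩ := hy
      obtain rfl : j = 1 := by ext; simp at hj ⊢; omega
      exact Or.inr hyB
  simp only [Set.mem_preimage, attachQEdge, hbc, if_true]
  split_ifs <;> first | omega | (exfalso; tauto)

lemma HasCoverPair.of_attachQ [Finite V] (hv : IsSupportVert G v ∨ IsLeafVert G v) {m : ℕ}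
    (h : HasCoverPair (_root_.attachQ G v r) m) : ∃ k, HasCoverPair G k ∧ k + 4 * r ≤ m := by
  obtain ⟨A, B, hAB, hm⟩ := h
  refine ⟨_, HasCoverPair.of_almost hv (A := Sum.inl ⁻¹' A)
    (B := Sym2.map Sum.inl ⁻¹' B) ?_ ?_ ?_, ?_⟩
  · intro x hx
    obtain ⟨y | ⟨i, j⟩, hy, hyB⟩ := hAB.exists_edge (Sum.inl x)
    · exact ⟨y, by simpa using hy, hyB⟩
    · simp only [attachQ_adj_inl_inr] at hy
      exact absurd hy.1 hx
  · intro x y hxy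
    exact hAB.mem_or_mem (Sum.inl x) (Sum.inl y) (by simpa using hxy)
  · intro x y hxy
    exact hAB.mem_or_edge_mem (Sum.inl x) (Sum.inl y) (by simpa using hxy)
  · have h1 := ncard_eq_add_of_sum A
    have h2 := hAB.four_mul_le
    have h3 := ncard_preimage_add_le (Sym2.map.injective Sum.inl_injective)
      (attachQEdge_injective v) (map_inl_ne_attachQEdge v) B
    omega

lemma isLeafVert_attachQ_inl (hr : 0 < r) (hv : ∃ u, G.Adj v u) (x : V) :
    IsLeafVert (attachQ G v r) (Sum.inl x) ↔ x ∈ leavesAway G v := by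
  constructor
  · rintro ⟨y, hy, h⟩
    have hxv : x ≠ v := by
      rintro rfl
      obtain ⟨u, hu⟩ := hv
      have h1 := h (Sum.inl u) (by simpa using hu)
      have h2 := h (Sum.inr (⟨0, hr⟩, 0)) (by simp)
      rw [← h2] at h1
      cases h1
    refine ⟨?_, hxv⟩
    rcases y with y | ⟨i, j⟩
    · refine ⟨y, by simpa using hy, fun z hz => ?_⟩
      simpa using h (Sum.inl z) (by simpa using hz)
    · simp only [attachQ_adj_inl_inr] at hy
      exact absurd hy.1 hxv
  · rintro ⟨⟨y, hy, h⟩, hxv⟩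
    refine ⟨Sum.inl y, by simpa using hy, ?_⟩
    rintro (z | ⟨i, j⟩) hz
    · rw [h z (by simpa using hz)]
    · simp only [attachQ_adj_inl_inr] at hz
      exact absurd hz.1 hxv

lemma isLeafVert_attachQ_inr (i : Fin r) (j : Fin 3) :
    IsLeafVert (attachQ G v r) (Sum.inr (i, j)) ↔ j = 2 := by
  constructor
  · intro h
    fin_cases j
    · have := h.unique (y₁ := Sum.inl v) (y₂ := Sum.inr (i, 1)) (by simp) (by simp)
      cases this
    · have := h.unique (y₁ := Sum.inr (i, 0)) (y₂ := Sum.inr (i, 2)) (by simp) (by simp)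
      simp at this
    · rfl
  · rintro rfl
    refine ⟨Sum.inr (i, 1), by simp, ?_⟩
    rintro (z | ⟨i', j⟩) hz
    · simp at hz
    · simp only [attachQ_adj_inr_inr] at hz
      obtain ⟨rfl, hj⟩ := hz
      obtain rfl : j = 1 := by ext; simp at hj ⊢; omega
      rfl

lemma isSupportVert_attachQ_inl (hr : 0 < r) (hv : ∃ u, G.Adj v u) (x : V) :
    IsSupportVert (attachQ G v r) (Sum.inl x) ↔ x ∈ supportsAway G v := by
  constructor
  · rintro ⟨y | ⟨i, j⟩, hy, h⟩
    · rw [isLeafVert_attachQ_inl hr hv] at h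
      exact ⟨y, by simpa using hy, h⟩
    · simp only [attachQ_adj_inl_inr] at hy
      rw [isLeafVert_attachQ_inr, hy.2] at h
      simp at h
  · rintro ⟨u, hxu, hu⟩
    exact ⟨Sum.inl u, by simpa using hxu, (isLeafVert_attachQ_inl hr hv u).2 hu⟩

lemma isSupportVert_attachQ_inr (hr : 0 < r) (hv : ∃ u, G.Adj v u) (i : Fin r) (j : Fin 3) :
    IsSupportVert (attachQ G v r) (Sum.inr (i, j)) ↔ j = 1 := by
  constructor
  · rintro ⟨y | ⟨i', k⟩, hy, h⟩
    · rw [isLeafVert_attachQ_inl hr hv] at h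
      simp only [attachQ_adj_inr_inl] at hy
      exact absurd hy.1 h.2
    · rw [isLeafVert_attachQ_inr] at h
      subst h
      simp only [attachQ_adj_inr_inr] at hy
      have := hy.2
      ext
      simp at this ⊢
      omega
  · rintro rfl
    exact ⟨Sum.inr (i, 2), by simp, (isLeafVert_attachQ_inr i 2).2 rfl⟩

lemma ncard_setOf_snd_eq (c : Fin 3) : {p : Fin r × Fin 3 | p.2 = c}.ncard = r := by
  have : {p : Fin r × Fin 3 | p.2 = c} = (fun i => (i, c)) '' Set.univ := by
    ext ⟨i, j⟩
    simp [eq_comm]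
  rw [this, Set.ncard_image_of_injective _ (fun a b h => by simpa using h), Set.ncard_univ,
    Nat.card_fin]

lemma ncard_leaves_attachQ [Finite V] (hr : 0 < r) (hv : ∃ u, G.Adj v u) :
    {x | IsLeafVert (attachQ G v r) x}.ncard = (leavesAway G v).ncard + r := by
  rw [ncard_eq_add_of_sum]
  congr 1
  · simp [isLeafVert_attachQ_inl hr hv, Set.preimage]
  · refine Eq.trans ?_ (ncard_setOf_snd_eq (r := r) 2)
    congr 1
    ext ⟨i, j⟩
    exact isLeafVert_attachQ_inr i j

lemma ncard_supports_attachQ [Finite V] (hr : 0 < r) (hv : ∃ u, G.Adj v u) :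
    {x | IsSupportVert (attachQ G v r) x}.ncard = (supportsAway G v).ncard + r := by
  rw [ncard_eq_add_of_sum]
  congr 1
  · simp [isSupportVert_attachQ_inl hr hv, Set.preimage]
  · refine Eq.trans ?_ (ncard_setOf_snd_eq (r := r) 1)
    congr 1
    ext ⟨i, j⟩
    exact isSupportVert_attachQ_inr hr hv i j

end AttachQ

section Family

variable {V W : Type u} {G : SimpleGraph V} {H : SimpleGraph W} {v : V} {r : ℕ}

/-- The upper bound is attained, with leaves and support vertices counted literally (also in
`P₂`, where the counts agree). -/
structure AttainsBound (G : SimpleGraph V) : Prop where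
  finite : Finite V
  two_le : 2 ≤ Nat.card V
  eq_of_card : Nat.card V = 2 → {x | IsLeafVert G x}.ncard = {x | IsSupportVert G x}.ncard
  exists_isLeast : ∃ k, IsLeast {m | HasCoverPair G m} k ∧
    3 * k + {x | IsLeafVert G x}.ncard + 2 = 4 * Nat.card V + {x | IsSupportVert G x}.ncard

lemma AttainsBound.of_iso (e : G ≃g H) (h : AttainsBound H) : AttainsBound G := by
  have := h.finite
  have hfin : Finite V := Finite.of_equiv W e.symm.toEquiv
  have hc : Nat.card V = Nat.card W := Nat.card_congr e.toEquiv
  have hl := ncard_setOf_of_iso e (isLeafVert_iso e)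
  have hs := ncard_setOf_of_iso e (isSupportVert_iso e)
  obtain ⟨k, hk, heq⟩ := h.exists_isLeast
  refine ⟨hfin, hc ▸ h.two_le, fun h2 => ?_, k, ⟨?_, fun m hm => hk.2 ?_⟩, ?_⟩
  · rw [← hl, ← hs]
    exact h.eq_of_card (hc ▸ h2)
  · exact HasCoverPair.of_iso e.symm hk.1
  · exact HasCoverPair.of_iso e hm
  · rw [← hl, ← hs, hc]
    exact heq

lemma AttainsBound.attachPath_one (hv : IsSupportVert G v) (h : AttainsBound G) :
    AttainsBound (attachPath G v 1) := by
  have := h.finite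
  have hc : Nat.card (V ⊕ Fin 1) = Nat.card V + 1 := by simp
  have h2 := h.two_le
  obtain ⟨k, hk, heq⟩ := h.exists_isLeast
  refine ⟨inferInstance, by omega, fun h => by omega, k + 1,
    ⟨hk.1.attachPath_one hv, fun m hm => ?_⟩, ?_⟩
  · obtain ⟨j, hj, hjm⟩ := HasCoverPair.of_attachPath_one hv hm
    exact (Nat.add_le_add_right (hk.2 hj) 1).trans hjm
  · have hb := leavesAway_add_supports (Or.inl hv)
    rw [ncard_leaves_attachPath_one hv, ncard_supports_attachPath_one hv, hc]
    omega

lemma AttainsBound.attachQ (hr : 0 < r) (hv : IsSupportVert G v ∨ IsWeakLeaf G v)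
    (h : AttainsBound G) : AttainsBound (attachQ G v r) := by
  have := h.finite
  have hc : Nat.card (V ⊕ Fin r × Fin 3) = Nat.card V + r * 3 := by simp
  have h2 := h.two_le
  have hadj : ∃ u, G.Adj v u := by
    rcases hv with ⟨u, hu, -⟩ | ⟨⟨u, hu, -⟩, -⟩ <;> exact ⟨u, hu⟩
  obtain ⟨k, hk, heq⟩ := h.exists_isLeast
  refine ⟨inferInstance, by omega, fun h => by omega, k + 4 * r,
    ⟨hk.1.attachQ, fun m hm => ?_⟩, ?_⟩
  · obtain ⟨j, hj, hjm⟩ := HasCoverPair.of_attachQ (hv.imp_right And.left) hm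
    exact (Nat.add_le_add_right (hk.2 hj) _).trans hjm
  · have hb := leavesAway_add_supports hv
    rw [ncard_leaves_attachQ hr hadj, ncard_supports_attachQ hr hadj, hc]
    omega

lemma AttainsBound.of_iso_pathGraph_two (e : G ≃g SimpleGraph.pathGraph 2) :
    AttainsBound G := by
  have hfin : Finite V := Finite.of_equiv _ e.symm.toEquiv
  have hc : Nat.card V = 2 := by rw [Nat.card_congr e.toEquiv, Nat.card_fin]
  have hadj : ∀ x y, G.Adj x y ↔ x ≠ y := fun x y => by
    rw [← e.map_adj_iff, ← e.injective.ne_iff]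
    simp only [SimpleGraph.pathGraph_two_eq_top, SimpleGraph.top_adj]
  obtain ⟨a, b, hab, huniv⟩ := Set.ncard_eq_two.1 ((Set.ncard_univ V).trans hc)
  have hx : ∀ x, x = a ∨ x = b := fun x => by simpa using huniv.subset (Set.mem_univ x)
  have hl : ∀ x, IsLeafVert G x := by
    intro x
    rcases hx x with rfl | rfl
    · exact ⟨b, (hadj _ _).2 hab, fun y hy => (hx y).resolve_left ((hadj _ _).1 hy).symm⟩
    · exact ⟨a, (hadj _ _).2 hab.symm, fun y hy => (hx y).resolve_right ((hadj _ _).1 hy).symm⟩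
  have hs : ∀ x, IsSupportVert G x := fun x => by
    obtain ⟨y, hy, -⟩ := hl x
    exact ⟨y, hy, hl y⟩
  refine ⟨hfin, hc.ge, fun _ => by simp [hl, hs], 2, ⟨?_, ?_⟩, by simp [hl, hs, hc]⟩
  · refine ⟨{a}, {s(a, b)}, ⟨fun x => ?_, fun x y h => ?_, fun x y h => ?_⟩, by simp⟩
    · rcases hx x with rfl | rfl
      · exact ⟨b, (hadj _ _).2 hab, rfl⟩
      · exact ⟨a, (hadj _ _).2 hab.symm, Sym2.eq_swap⟩
    · rw [hadj] at h
      rcases hx x with rfl | rfl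
      · simp
      · exact Or.inr ((hx y).resolve_right h.symm)
    · rw [hadj] at h
      rcases hx x with rfl | rfl
      · simp
      · rw [(hx y).resolve_right h.symm]
        exact Or.inr Sym2.eq_swap
  · rintro m ⟨A, B, hAB, hm⟩
    obtain ⟨y, -, hy⟩ := hAB.exists_edge a
    have hB : 0 < B.ncard := (Set.ncard_pos).2 ⟨_, hy⟩
    have hA : 0 < A.ncard := by
      rcases hAB.mem_or_mem a b ((hadj _ _).2 hab) with h | h <;>
        exact (Set.ncard_pos).2 ⟨_, h⟩
    omega

lemma InFamilyT.attainsBound {V : Type u} {G : SimpleGraph V} (h : InFamilyT G) :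
    AttainsBound G := by
  induction h with
  | base G e => exact AttainsBound.of_iso_pathGraph_two e
  | op1 hv _ G e ih => exact (ih.attachPath_one hv).of_iso e
  | op2 hv _ G e ih =>
    exact (ih.attachQ one_pos hv).of_iso (e.trans (attachPathThreeIso _ _))
  | op3 hv _ hr G e ih => exact (ih.attachQ (by omega) (Or.inr hv)).of_iso e

end Family

theorem familyT_implies_upper_equality {V : Type u} [Fintype V]
    (T : SimpleGraph V) (hT : T.IsTree) (hn : 2 ≤ Nat.card V) (hF : InFamilyT T) :
    (toidNumber (subdivision T) : ℚ) = (4 * (Nat.card V : ℚ) - leafCount T + supportCount T - 2) / 3 := by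
  obtain ⟨hfin, -, h2, k, hk, heq⟩ := hF.attainsBound
  have key : 3 * k + leafCount T + 2 = 4 * Nat.card V + supportCount T := by
    unfold leafCount supportCount
    split_ifs with hc
    · have := h2 hc
      omega
    · exact heq
  rw [toidNumber_subdivision_eq hk]
  have keyQ : (3 * k + leafCount T + 2 : ℚ) = 4 * Nat.card V + supportCount T := by
    exact_mod_cast key
  linarith
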